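/- Let k be a field, S := k[U,V]/(U², V²) and T := k[X,Y]/(X², Y²), and let R := S ×_k T be the fiber product. Denote by u, v, x, y the residues of U, V, X, Y in R. Set M := R/(u+x)R and N := R/(v+y)R. Then for every i ≥ 0, Tor_i^R(M, N) = 0 if and only if i = 2 or i = 3. -/

import Mathlib

open CategoryTheory Opposite IsLocalRing

noncomputable section

set_option maxHeartbeats 1000000
set_option synthInstance.maxHeartbeats 1000000

/-- Vanishing of `Tor_i^A(M, N)`. -/
abbrev TorZero (A : Type) [CommRing A] (M N : Type) [AddCommGroup M] [Module A M]
    [AddCommGroup N] [Module A N] (i : ℕ) : Prop :=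
  Subsingleton (((Tor (ModuleCat A) i).obj (ModuleCat.of A M)).obj (ModuleCat.of A N))

/-- Vanishing of `Ext^i_A(M, N)`. -/
abbrev ExtZero (A : Type) [CommRing A] (M N : Type) [AddCommGroup M] [Module A M]
    [AddCommGroup N] [Module A N] (i : ℕ) : Prop :=
  Subsingleton (((Ext A (ModuleCat A) i).obj (op (ModuleCat.of A M))).obj (ModuleCat.of A N))

/-- `M` has projective dimension at most `n` over `A`:
`Ext^i_A(M, -) = 0` for all `i > n`. -/
def PdLE (A : Type) [CommRing A] (M : Type) [AddCommGroup M] [Module A M] (n : ℕ) : Prop :=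
  ∀ (N : ModuleCat A) (i : ℕ), n < i →
    Subsingleton (((Ext A (ModuleCat A) i).obj (op (ModuleCat.of A M))).obj N)

/-- `N` has injective dimension at most `n` over `A`:
`Ext^i_A(-, N) = 0` for all `i > n`. -/
def IdLE (A : Type) [CommRing A] (N : Type) [AddCommGroup N] [Module A N] (n : ℕ) : Prop :=
  ∀ (X : ModuleCat A) (i : ℕ), n < i →
    Subsingleton (((Ext A (ModuleCat A) i).obj (op X)).obj (ModuleCat.of A N))

/-- The depth of a module over a noetherian local ring, as an extended natural number:
`inf { i | Ext^i_A(k, M) ≠ 0 }`. -/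
def depthM (A : Type) [CommRing A] [IsLocalRing A] (M : Type) [AddCommGroup M]
    [Module A M] : ℕ∞ :=
  sInf {n : ℕ∞ | ∃ i : ℕ, n = i ∧
    ¬ Subsingleton (((Ext A (ModuleCat A) i).obj
        (op (ModuleCat.of A (A ⧸ maximalIdeal A)))).obj (ModuleCat.of A M))}

/-- The fiber product `S ×ₖ T` as a subring of `S × T`. -/
def fiberProd {S T k : Type} [CommRing S] [CommRing T] [CommRing k]
    (πS : S →+* k) (πT : T →+* k) : Subring (S × T) :=
  RingHom.eqLocus (πS.comp (RingHom.fst S T)) (πT.comp (RingHom.snd S T))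

/-- The projection from the fiber product to `S`. -/
def ρS {S T k : Type} [CommRing S] [CommRing T] [CommRing k]
    (πS : S →+* k) (πT : T →+* k) : ↥(fiberProd πS πT) →+* S :=
  (RingHom.fst S T).comp (fiberProd πS πT).subtype

/-- The projection from the fiber product to `T`. -/
def ρT {S T k : Type} [CommRing S] [CommRing T] [CommRing k]
    (πS : S →+* k) (πT : T →+* k) : ↥(fiberProd πS πT) →+* T :=
  (RingHom.snd S T).comp (fiberProd πS πT).subtype

/-- The `i`-th Betti number of a module `M` over a noetherian local ring `A`:
the `k`-dimension of `Tor_i^A(M, k) ⊗_A k`; since `Tor_i^A(M, k)` is annihilated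
by the maximal ideal, this is `dim_k Tor_i^A(M, k)`. -/
noncomputable def betti (A : Type) [CommRing A] [IsLocalRing A] (M : Type) [AddCommGroup M]
    [Module A M] (i : ℕ) : ℕ :=
  let X : ModuleCat A :=
    ((Tor (ModuleCat A) i).obj (ModuleCat.of A M)).obj (ModuleCat.of A (A ⧸ maximalIdeal A))
  Module.finrank (A ⧸ maximalIdeal A) (X ⧸ (maximalIdeal A • (⊤ : Submodule A X)))

/-- `M` is a first syzygy over `A` of a finitely generated `A`-module, i.e. `M` embeds
into a finite free `A`-module (as the kernel of `F ↠ L` for the quotient `L`). -/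
def IsFirstSyzygy (A : Type) [CommRing A] (M : Type) [AddCommGroup M] [Module A M] : Prop :=
  ∃ (n : ℕ) (f : M →ₗ[A] (Fin n → A)), Function.Injective f

namespace Stmt9

variable (k : Type) [Field k]

/-- `S = k[U,V]/(U²,V²)`. -/
abbrev Sring : Type :=
  MvPolynomial (Fin 2) k ⧸
    (Ideal.span {MvPolynomial.X 0 ^ 2, MvPolynomial.X 1 ^ 2} : Ideal (MvPolynomial (Fin 2) k))

/-- `T = k[X,Y]/(X²,Y²)`. -/
abbrev Tring : Type := Sring k

/-- The canonical surjection `S → k` (evaluation of the variables at `0`). -/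
noncomputable def πS : Sring k →+* k :=
  Ideal.Quotient.lift _ (MvPolynomial.aeval (fun _ => (0 : k))).toRingHom
    (by
      intro a ha
      rw [← RingHom.mem_ker] at *
      revert a ha
      rw [← SetLike.le_def]
      refine Ideal.span_le.mpr ?_
      rintro p (rfl | rfl) <;> simp [RingHom.mem_ker])

/-- The canonical surjection `T → k`. -/
noncomputable def πT : Tring k →+* k := πS k

/-- The fiber product `R = S ×ₖ T`. -/
noncomputable abbrev Rring : Type := ↥(fiberProd (πS k) (πT k))

/-- The residue `u` of `U` in `R`. -/
noncomputable def u : Rring k :=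
  ⟨(Ideal.Quotient.mk _ (MvPolynomial.X 0), 0), by
    show πS k (Ideal.Quotient.mk _ (MvPolynomial.X 0)) = πT k 0
    simp [πS, πT, Ideal.Quotient.lift_mk]⟩

/-- The residue `v` of `V` in `R`. -/
noncomputable def v : Rring k :=
  ⟨(Ideal.Quotient.mk _ (MvPolynomial.X 1), 0), by
    show πS k (Ideal.Quotient.mk _ (MvPolynomial.X 1)) = πT k 0
    simp [πS, πT, Ideal.Quotient.lift_mk]⟩

/-- The residue `x` of `X` in `R`. -/
noncomputable def x : Rring k :=
  ⟨(0, Ideal.Quotient.mk _ (MvPolynomial.X 0)), by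
    show πS k 0 = πT k (Ideal.Quotient.mk _ (MvPolynomial.X 0))
    simp [πS, πT, Ideal.Quotient.lift_mk]⟩

/-- The residue `y` of `Y` in `R`. -/
noncomputable def y : Rring k :=
  ⟨(0, Ideal.Quotient.mk _ (MvPolynomial.X 1)), by
    show πS k 0 = πT k (Ideal.Quotient.mk _ (MvPolynomial.X 1))
    simp [πS, πT, Ideal.Quotient.lift_mk]⟩

end Stmt9

namespace CategoryTheory
open Limits

variable {C : Type*} [Category* C] [Abelian C]

namespace ProjectiveResolution

/-- The augmentation `P₀ ⟶ X` of a projective resolution of `X`. -/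
def augmentation {X : C} (P : ProjectiveResolution X) : P.complex.X 0 ⟶ X := P.π.f 0

lemma d_comp_augmentation {X : C} (P : ProjectiveResolution X) :
    P.complex.d 1 0 ≫ P.augmentation = 0 := P.complex_d_comp_π_f_zero

instance {X : C} (P : ProjectiveResolution X) : Epi P.augmentation :=
  inferInstanceAs (Epi (P.π.f 0))

lemma exact_augmentation {X : C} (P : ProjectiveResolution X) :
    (ShortComplex.mk _ _ P.d_comp_augmentation).Exact := P.exact₀

lemma d_comp_augmentation_comp_f {S : ShortComplex C} (P : ProjectiveResolution S.X₁) :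
    P.complex.d 1 0 ≫ P.augmentation ≫ S.f = 0 := by
  rw [← Category.assoc, d_comp_augmentation, zero_comp]

/-- Splice a resolution of `X₁` with `X₂`, for a short complex `X₁ ⟶ X₂ ⟶ X₃`. -/
def spliceComplex (S : ShortComplex C) (P : ProjectiveResolution S.X₁) : ChainComplex C ℕ :=
  P.complex.augment (X := S.X₂) (P.augmentation ≫ S.f) P.d_comp_augmentation_comp_f

lemma spliceComplex_exactAt_succ {S : ShortComplex C} (hS : S.ShortExact)
    (P : ProjectiveResolution S.X₁) (n : ℕ) : (spliceComplex S P).ExactAt (n + 1) := by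
  rw [HomologicalComplex.exactAt_iff' _ (n + 1 + 1) (n + 1) n (by simp) (by simp)]
  match n with
  | 0 =>
    let α : ShortComplex.mk _ _ P.d_comp_augmentation ⟶
        ShortComplex.mk (P.complex.d 1 0) (P.augmentation ≫ S.f)
          P.d_comp_augmentation_comp_f :=
      { τ₁ := 𝟙 _, τ₂ := 𝟙 _, τ₃ := S.f }
    have : Mono α.τ₃ := hS.mono_f
    have : Epi α.τ₁ := inferInstanceAs (Epi (𝟙 _))
    have : IsIso α.τ₂ := inferInstanceAs (IsIso (𝟙 _))
    exact (ShortComplex.exact_iff_of_epi_of_isIso_of_mono α).1 P.exact_augmentation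
  | n + 1 => exact P.exact_succ n

lemma spliceComplex_exact₀ {S : ShortComplex C} (hS : S.ShortExact)
    (P : ProjectiveResolution S.X₁) :
    (ShortComplex.mk (P.augmentation ≫ S.f) S.g (by simp)).Exact := by
  let α : ShortComplex.mk (P.augmentation ≫ S.f) S.g (by simp) ⟶ S :=
    { τ₁ := P.augmentation, τ₂ := 𝟙 _, τ₃ := 𝟙 _ }
  have : Epi α.τ₁ := inferInstanceAs (Epi P.augmentation)
  have : IsIso α.τ₂ := inferInstanceAs (IsIso (𝟙 _))
  have : Mono α.τ₃ := inferInstanceAs (Mono (𝟙 _))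
  exact (ShortComplex.exact_iff_of_epi_of_isIso_of_mono α).2 hS.exact

lemma quasiIso_toSingle₀ (K : ChainComplex C ℕ) {X : C} (f : K.X 0 ⟶ X) (w : K.d 1 0 ≫ f = 0)
    (h₀ : (ShortComplex.mk _ _ w).Exact) (hf : Epi f) (hK : ∀ n, K.ExactAt (n + 1)) :
    QuasiIso ((ChainComplex.toSingle₀Equiv K X).symm ⟨f, w⟩) where
  quasiIsoAt n := by
    cases n
    · rw [ChainComplex.quasiIsoAt₀_iff, ShortComplex.quasiIso_iff_of_zeros']
      · refine (ShortComplex.exact_and_epi_g_iff_of_iso ?_).2 ⟨h₀, hf⟩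
        exact ShortComplex.isoMk (Iso.refl _) (Iso.refl _) (Iso.refl _)
          ((Category.id_comp _).trans (Category.comp_id _).symm)
          ((Category.id_comp _).trans
            ((ChainComplex.toSingle₀Equiv_symm_apply_f_zero f w).symm.trans
              (Category.comp_id _).symm))
      · exact K.shape 0 0 (by simp)
      · rfl
      · rfl
    · rw [quasiIsoAt_iff_exactAt']
      · exact hK _
      · exact ChainComplex.exactAt_succ_single_obj _ _

/-- For a short exact sequence with projective middle term, a projective resolution of the
first term yields one of the third. -/
def splice {S : ShortComplex C} (hS : S.ShortExact) [Projective S.X₂]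
    (P : ProjectiveResolution S.X₁) : ProjectiveResolution S.X₃ where
  complex := spliceComplex S P
  projective
    | 0 => inferInstanceAs (Projective S.X₂)
    | n + 1 => inferInstanceAs (Projective (P.complex.X n))
  π := (ChainComplex.toSingle₀Equiv (spliceComplex S P) S.X₃).symm
    ⟨S.g, (ShortComplex.mk (P.augmentation ≫ S.f) S.g (by simp)).zero⟩
  quasiIso := quasiIso_toSingle₀ (spliceComplex S P) S.g _ (spliceComplex_exact₀ hS P) hS.epi_g
    (spliceComplex_exactAt_succ hS P)

lemma isZero_leftDerived_succ_iff {D : Type*} [Category* D] [Abelian D]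
    [HasProjectiveResolutions C] {X : C} (P : ProjectiveResolution X) (F : C ⥤ D) [F.Additive]
    (n : ℕ) : IsZero ((F.leftDerived (n + 1)).obj X) ↔
      ((ShortComplex.mk _ _ (P.complex.d_comp_d (n + 2) (n + 1) n)).map F).Exact := by
  rw [(P.isoLeftDerivedObj F (n + 1)).isZero_iff]
  refine (HomologicalComplex.exactAt_iff_isZero_homology _ _).symm.trans ?_
  exact HomologicalComplex.exactAt_iff' _ (n + 2) (n + 1) n (by simp) (by simp)

end ProjectiveResolution

lemma ShortComplex.ShortExact.isZero_leftDerived_add_two_iff {D : Type*} [Category* D] [Abelian D]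
    [HasProjectiveResolutions C] {S : ShortComplex C} (hS : S.ShortExact) [Projective S.X₂]
    (F : C ⥤ D) [F.Additive] (n : ℕ) :
    IsZero ((F.leftDerived (n + 2)).obj S.X₃) ↔ IsZero ((F.leftDerived (n + 1)).obj S.X₁) := by
  let P := projectiveResolution S.X₁
  rw [P.isZero_leftDerived_succ_iff, (P.splice hS).isZero_leftDerived_succ_iff]
  rfl

end CategoryTheory

section
variable {A : Type} [CommRing A] {M N N' P : Type} [AddCommGroup M] [Module A M]
    [AddCommGroup N] [Module A N] [AddCommGroup N'] [Module A N'] [AddCommGroup P] [Module A P]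

lemma torZero_iff_isZero (i : ℕ) : TorZero A M N i ↔
    Limits.IsZero (((Tor (ModuleCat A) i).obj (ModuleCat.of A M)).obj (ModuleCat.of A N)) :=
  ModuleCat.isZero_iff_subsingleton.symm

lemma TorZero.of_retract (f : N →ₗ[A] N') (g : N' →ₗ[A] N) (h : ∀ z, g (f z) = z) {i : ℕ}
    (hN' : TorZero A M N' i) : TorZero A M N i := by
  rw [torZero_iff_isZero] at *
  let r : Retract (ModuleCat.of A N) (ModuleCat.of A N') :=
    { i := ModuleCat.ofHom f, r := ModuleCat.ofHom g, retract := by ext z; exact h z }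
  exact hN'.of_mono (r.map ((Tor (ModuleCat A) i).obj (ModuleCat.of A M))).i

lemma torZero_add_two_iff [Module.Projective A P] (f : N' →ₗ[A] P) (g : P →ₗ[A] N)
    (hf : Function.Injective f) (hfg : Function.Exact f g) (hg : Function.Surjective g) (i : ℕ) :
    TorZero A M N (i + 2) ↔ TorZero A M N' (i + 1) := by
  have : Projective (ModuleCat.of A P) := (IsProjective.iff_projective P).1 inferInstance
  let S : ShortComplex (ModuleCat A) := ShortComplex.mk (ModuleCat.ofHom f) (ModuleCat.ofHom g)
    (by ext z; exact hfg.apply_apply_eq_zero z)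
  have hS : S.ShortExact :=
    { exact := (ShortComplex.ShortExact.moduleCat_exact_iff_function_exact _).2 hfg
      mono_f := (ModuleCat.mono_iff_injective _).2 hf
      epi_g := (ModuleCat.epi_iff_surjective _).2 hg }
  have : Projective S.X₂ := this
  rw [torZero_iff_isZero, torZero_iff_isZero]
  exact hS.isZero_leftDerived_add_two_iff _ i
end

section
open TensorProduct
variable {A : Type} [CommRing A]

lemma one_tmul_eq_zero_iff {P : Type*} [AddCommGroup P] [Module A P] (a : A) (p : P) :
    (1 : A ⧸ Ideal.span {a}) ⊗ₜ[A] p = 0 ↔ ∃ p', p = a • p' := by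
  rw [← (TensorProduct.quotTensorEquivQuotSMul P (Ideal.span {a})).map_eq_zero_iff,
    ← map_one (Ideal.Quotient.mk _), TensorProduct.quotTensorEquivQuotSMul_mk_tmul, one_smul,
    Submodule.Quotient.mk_eq_zero, Submodule.ideal_span_singleton_smul,
    Submodule.mem_smul_pointwise_iff_exists]
  simp [eq_comm]

lemma exists_eq_one_tmul {P : Type*} [AddCommGroup P] [Module A P] {I : Ideal A}
    (z : (A ⧸ I) ⊗[A] P) : ∃ p : P, z = 1 ⊗ₜ p := by
  induction z with
  | zero => exact ⟨0, by simp⟩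
  | tmul r p =>
    obtain ⟨r, rfl⟩ := Ideal.Quotient.mk_surjective r
    refine ⟨r • p, ?_⟩
    rw [TensorProduct.tmul_smul, TensorProduct.smul_tmul', Algebra.smul_def, mul_one]
    rfl
  | add z w hz hw =>
    obtain ⟨p, rfl⟩ := hz
    obtain ⟨q, rfl⟩ := hw
    exact ⟨p + q, by rw [TensorProduct.tmul_add]⟩

lemma mem_torsionOf_smul_top_of_projective {P : Type*} [AddCommGroup P] [Module A P]
    [Module.Projective A P] {a : A} {p : P} (h : a • p = 0) :
    p ∈ Ideal.torsionOf A A a • (⊤ : Submodule A P) := by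
  obtain ⟨s, hs⟩ := Module.projective_def'.1 ‹Module.Projective A P›
  have hp : Finsupp.linearCombination A id (s p) = p := LinearMap.congr_fun hs p
  rw [← hp, Finsupp.linearCombination_apply]
  refine Submodule.sum_mem _ fun e _ ↦ Submodule.smul_mem_smul ?_ trivial
  have := DFunLike.congr_fun (congrArg s h) e
  rw [Ideal.mem_torsionOf_iff, smul_eq_mul, mul_comm]
  simpa using this

lemma exact_map_tensoringLeft_iff {S : ShortComplex (ModuleCat A)} (a : A) :
    (S.map ((MonoidalCategory.tensoringLeft (ModuleCat A)).obj
      (ModuleCat.of A (A ⧸ Ideal.span {a})))).Exact ↔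
      ∀ p : S.X₂, (∃ q, S.g p = a • q) → ∃ r q, p = S.f r + a • q := by
  rw [ShortComplex.moduleCat_exact_iff]
  have hf (r : S.X₁) : (1 : A ⧸ Ideal.span {a}) ⊗ₜ[A] S.f r =
    (S.map ((MonoidalCategory.tensoringLeft (ModuleCat A)).obj
      (ModuleCat.of A (A ⧸ Ideal.span {a})))).f (1 ⊗ₜ[A] r) := rfl
  have hg (r : S.X₂) : (1 : A ⧸ Ideal.span {a}) ⊗ₜ[A] S.g r =
    (S.map ((MonoidalCategory.tensoringLeft (ModuleCat A)).obj
      (ModuleCat.of A (A ⧸ Ideal.span {a})))).g (1 ⊗ₜ[A] r) := rfl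
  constructor
  · intro h p hp
    obtain ⟨z, hz⟩ := h (1 ⊗ₜ[A] p) ((hg p).symm.trans ((one_tmul_eq_zero_iff a _).2 hp))
    obtain ⟨r, rfl⟩ := exists_eq_one_tmul z
    have hz' : (1 : A ⧸ Ideal.span {a}) ⊗ₜ[A] (p - S.f r) = 0 := by
      rw [TensorProduct.tmul_sub, sub_eq_zero]
      exact hz.symm
    obtain ⟨q, hq⟩ := (one_tmul_eq_zero_iff a _).1 hz'
    exact ⟨r, q, by rw [← hq]; abel⟩
  · intro h z hz
    obtain ⟨p, rfl⟩ := exists_eq_one_tmul z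
    obtain ⟨r, q, hp⟩ := h p ((one_tmul_eq_zero_iff a _).1 ((hg p).trans hz))
    refine ⟨1 ⊗ₜ[A] r, ?_⟩
    refine (hf r).symm.trans ?_
    rw [← sub_eq_zero, ← TensorProduct.tmul_sub, one_tmul_eq_zero_iff]
    exact ⟨-q, by rw [hp]; simp⟩

/-- For `a ∈ A`, the module `Tor_1(A/a, N)` vanishes iff every element of `N` killed by `a`
lies in `ann(a) N`. -/
lemma torZero_one_iff {N : Type} [AddCommGroup N] [Module A N] (a : A) :
    TorZero A (A ⧸ Ideal.span {a}) N 1 ↔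
      ∀ z : N, a • z = 0 → z ∈ Ideal.torsionOf A A a • (⊤ : Submodule A N) := by
  let P := projectiveResolution (ModuleCat.of A N)
  let d₁ : P.complex.X 1 →ₗ[A] P.complex.X 0 := (P.complex.d 1 0).hom
  let d₂ : P.complex.X 2 →ₗ[A] P.complex.X 1 := (P.complex.d 2 1).hom
  let ε : P.complex.X 0 →ₗ[A] N := P.augmentation.hom
  have hε : Function.Surjective ε := (ModuleCat.epi_iff_surjective P.augmentation).1 inferInstance
  have h₀ (p) : ε p = 0 → ∃ q, d₁ q = p :=
    (ShortComplex.moduleCat_exact_iff _).1 P.exact_augmentation p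
  have h₁ (p) : d₁ p = 0 → ∃ q, d₂ q = p :=
    (ShortComplex.moduleCat_exact_iff _).1 (P.exact_succ 0) p
  have hd₁ (p) : ε (d₁ p) = 0 := ConcreteCategory.congr_hom P.d_comp_augmentation p
  have hd₂ (p) : d₁ (d₂ p) = 0 := ConcreteCategory.congr_hom (P.complex.d_comp_d 2 1 0) p
  have : Module.Projective A (P.complex.X 0) :=
    (IsProjective.iff_projective _).2 (inferInstanceAs (Projective (P.complex.X 0)))
  rw [torZero_iff_isZero]
  refine (P.isZero_leftDerived_succ_iff _ 0).trans ((exact_map_tensoringLeft_iff a).trans ?_)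
  change (∀ p, (∃ q, d₁ p = a • q) → ∃ r q, p = d₂ r + a • q) ↔ _
  have hmap (J : Ideal A) : (J • ⊤ : Submodule A (P.complex.X 0)).map ε = J • ⊤ := by
    rw [Submodule.map_smul'', Submodule.map_top, LinearMap.range_eq_top.2 hε]
  rw [← hmap]
  constructor
  · intro h z hz
    obtain ⟨p₀, rfl⟩ := hε z
    rw [← map_smul] at hz
    obtain ⟨p₁, hp₁⟩ := h₀ _ hz
    obtain ⟨r, q, rfl⟩ := h p₁ ⟨p₀, hp₁⟩
    refine ⟨p₀ - d₁ q, mem_torsionOf_smul_top_of_projective ?_, by simp [hd₁]⟩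
    rw [smul_sub, ← hp₁]
    simp [hd₂]
  · rintro h p₁ ⟨p₀, hp₀⟩
    obtain ⟨p', hp', hε'⟩ := h (ε p₀) (by rw [← map_smul, ← hp₀, hd₁])
    have hap' : a • p' = 0 := by
      refine Submodule.smul_induction_on hp' (fun r hr n _ ↦ ?_) (fun x y hx hy ↦ ?_)
      · rw [smul_smul, mul_comm, ← smul_eq_mul, (Ideal.mem_torsionOf_iff a r).1 hr, zero_smul]
      · rw [smul_add, hx, hy, add_zero]
    obtain ⟨q, hq⟩ := h₀ (p₀ - p') (by rw [map_sub, hε', sub_self])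
    obtain ⟨r, hr⟩ := h₁ (p₁ - a • q) (by
      rw [map_sub, map_smul, hq, hp₀, smul_sub, hap', sub_zero, sub_self])
    exact ⟨r, q, by rw [hr]; abel⟩

lemma torZero_zero_iff {N : Type} [AddCommGroup N] [Module A N] (a : A) :
    TorZero A (A ⧸ Ideal.span {a}) N 0 ↔ ∀ z : N, ∃ w, z = a • w := by
  let F := (MonoidalCategory.tensoringLeft (ModuleCat A)).obj (ModuleCat.of A (A ⧸ Ideal.span {a}))
  have : Limits.PreservesFiniteColimits F :=
    inferInstanceAs (Limits.PreservesFiniteColimits (MonoidalCategory.tensorLeft _))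
  rw [torZero_iff_isZero]
  refine ((F.leftDerivedZeroIsoSelf.app (ModuleCat.of A N)).isZero_iff).trans
    (ModuleCat.isZero_iff_subsingleton.trans ?_)
  change Subsingleton ((A ⧸ Ideal.span {a}) ⊗[A] N) ↔ _
  refine ⟨fun h z ↦ (one_tmul_eq_zero_iff a z).1 (Subsingleton.elim _ _),
    fun h ↦ subsingleton_of_forall_eq 0 fun z ↦ ?_⟩
  obtain ⟨p, rfl⟩ := exists_eq_one_tmul z
  exact (one_tmul_eq_zero_iff a p).2 (h p)
end

section
variable {A : Type} [CommRing A] {M : Type} [AddCommGroup M] [Module A M]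

lemma torZero_quotient_add_two_iff (I : Ideal A) (i : ℕ) :
    TorZero A M (A ⧸ I) (i + 2) ↔ TorZero A M I (i + 1) :=
  torZero_add_two_iff I.subtype I.mkQ I.injective_subtype (LinearMap.exact_subtype_mkQ I)
    I.mkQ_surjective i

lemma torZero_span_singleton_add_two_iff (b : A) (i : ℕ) :
    TorZero A M (Ideal.span {b}) (i + 2) ↔ TorZero A M (Ideal.torsionOf A A b) (i + 1) := by
  let g : A →ₗ[A] Ideal.span {b} := (LinearMap.toSpanSingleton A A b).codRestrict (Ideal.span {b})
    fun r ↦ Ideal.mul_mem_left _ r (Ideal.mem_span_singleton_self b)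
  refine torZero_add_two_iff (Submodule.subtype _) g (Submodule.injective_subtype _) ?_ ?_ i
  · intro r
    have : g r = 0 ↔ r ∈ Ideal.torsionOf A A b := by
      rw [Ideal.mem_torsionOf_iff, Subtype.ext_iff]
      rfl
    simp [this]
  · rintro ⟨z, hz⟩
    obtain ⟨r, hr⟩ := Ideal.mem_span_singleton'.1 hz
    exact ⟨r, Subtype.ext hr⟩
end

namespace Stmt9

variable {k : Type} [Field k]

/-- The residue of the first variable in `S`. -/
def U : Sring k := Ideal.Quotient.mk _ (MvPolynomial.X 0)

/-- The residue of the second variable in `S`. -/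
def V : Sring k := Ideal.Quotient.mk _ (MvPolynomial.X 1)

lemma U_mul_U : (U * U : Sring k) = 0 := by
  rw [← sq]
  exact Ideal.Quotient.eq_zero_iff_mem.2 (Ideal.subset_span (by simp))

lemma V_mul_V : (V * V : Sring k) = 0 := by
  rw [← sq]
  exact Ideal.Quotient.eq_zero_iff_mem.2 (Ideal.subset_span (by simp))

/-- The element of `S` with given coordinates in the basis `1, U, V, UV`. -/
def ofCoords (c₀ c₁ c₂ c₃ : k) : Sring k :=
  algebraMap k _ c₀ + algebraMap k _ c₁ * U + algebraMap k _ c₂ * V + algebraMap k _ c₃ * (U * V)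

lemma exists_eq_ofCoords (s : Sring k) : ∃ c₀ c₁ c₂ c₃ : k, s = ofCoords c₀ c₁ c₂ c₃ := by
  obtain ⟨p, rfl⟩ := Ideal.Quotient.mk_surjective s
  induction p using MvPolynomial.induction_on with
  | C c =>
    refine ⟨c, 0, 0, 0, ?_⟩
    simp only [ofCoords, map_zero, zero_mul, add_zero]
    rfl
  | add p q hp hq =>
    obtain ⟨c₀, c₁, c₂, c₃, hp⟩ := hp
    obtain ⟨d₀, d₁, d₂, d₃, hq⟩ := hq
    refine ⟨c₀ + d₀, c₁ + d₁, c₂ + d₂, c₃ + d₃, ?_⟩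
    simp only [map_add, hp, hq, ofCoords]
    ring
  | mul_X p i hp =>
    obtain ⟨c₀, c₁, c₂, c₃, hp⟩ := hp
    fin_cases i
    · refine ⟨0, c₀, 0, c₂, ?_⟩
      rw [map_mul, hp]
      change _ * U = _
      simp only [ofCoords, map_zero]
      linear_combination (algebraMap k _ c₁ + algebraMap k _ c₃ * V) * U_mul_U (k := k)
    · refine ⟨0, 0, c₀, c₁, ?_⟩
      rw [map_mul, hp]
      change _ * V = _
      simp only [ofCoords, map_zero]
      linear_combination (algebraMap k _ c₂ + algebraMap k _ c₃ * U) * V_mul_V (k := k)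

/-- The homomorphism from `k[U,V]` to the iterated dual numbers sending the variables to the two
infinitesimals. -/
def polyToDualNumber : MvPolynomial (Fin 2) k →+* DualNumber (DualNumber k) :=
  MvPolynomial.eval₂Hom (σ := Fin 2) (S₁ := DualNumber (DualNumber k))
    ((TrivSqZeroExt.inlHom (DualNumber k) (DualNumber k)).comp (TrivSqZeroExt.inlHom k k))
    ![TrivSqZeroExt.inl DualNumber.eps, DualNumber.eps]

lemma polyToDualNumber_X_zero : polyToDualNumber (MvPolynomial.X 0 : MvPolynomial (Fin 2) k) =
    TrivSqZeroExt.inl DualNumber.eps := by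
  simp [polyToDualNumber]

lemma polyToDualNumber_X_one : polyToDualNumber (MvPolynomial.X 1 : MvPolynomial (Fin 2) k) =
    DualNumber.eps := by
  simp [polyToDualNumber]

lemma polyToDualNumber_C (c : k) : polyToDualNumber (MvPolynomial.C c) =
    TrivSqZeroExt.inl (TrivSqZeroExt.inl c) := by
  simp [polyToDualNumber]

/-- The homomorphism from `S` to the iterated dual numbers sending `U` and `V` to the two
infinitesimals. -/
def toDualNumber : Sring k →+* DualNumber (DualNumber k) :=
  Ideal.Quotient.lift _ polyToDualNumber (by
    intro p hp
    rw [← RingHom.mem_ker]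
    revert p hp
    rw [← SetLike.le_def]
    refine Ideal.span_le.2 ?_
    rintro p (rfl | rfl)
    · simp [RingHom.mem_ker, sq, polyToDualNumber_X_zero, ← TrivSqZeroExt.inl_mul]
    · simp [RingHom.mem_ker, sq, polyToDualNumber_X_one])

lemma toDualNumber_U : toDualNumber (U : Sring k) = TrivSqZeroExt.inl DualNumber.eps := by
  simp [toDualNumber, U, polyToDualNumber_X_zero]

lemma toDualNumber_V : toDualNumber (V : Sring k) = DualNumber.eps := by
  simp [toDualNumber, V, polyToDualNumber_X_one]

lemma toDualNumber_algebraMap (c : k) :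
    toDualNumber (algebraMap k (Sring k) c) = TrivSqZeroExt.inl (TrivSqZeroExt.inl c) := by
  change toDualNumber (Ideal.Quotient.mk _ (MvPolynomial.C c)) = _
  simp [toDualNumber, polyToDualNumber_C]

lemma ofCoords_eq_zero {c₀ c₁ c₂ c₃ : k} (h : ofCoords c₀ c₁ c₂ c₃ = 0) :
    c₀ = 0 ∧ c₁ = 0 ∧ c₂ = 0 ∧ c₃ = 0 := by
  have h' := congrArg toDualNumber h
  simp only [ofCoords, map_add, map_mul, toDualNumber_algebraMap, toDualNumber_U,
    toDualNumber_V, map_zero] at h'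
  refine ⟨?_, ?_, ?_, ?_⟩
  · simpa using congrArg (fun z ↦ z.fst.fst) h'
  · simpa using congrArg (fun z ↦ z.fst.snd) h'
  · simpa using congrArg (fun z ↦ z.snd.fst) h'
  · simpa using congrArg (fun z ↦ z.snd.snd) h'

lemma πS_U : πS k U = 0 := by simp [πS, U]

lemma πS_V : πS k V = 0 := by simp [πS, V]

lemma πS_algebraMap (c : k) : πS k (algebraMap k _ c) = c := by
  change πS k (Ideal.Quotient.mk _ (MvPolynomial.C c)) = c
  simp [πS]

lemma πS_ofCoords (c₀ c₁ c₂ c₃ : k) : πS k (ofCoords c₀ c₁ c₂ c₃) = c₀ := by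
  simp [ofCoords, πS_U, πS_V, πS_algebraMap]

lemma exists_eq_mul_V {s : Sring k} (h : s * V = 0) : ∃ s', s = s' * V := by
  obtain ⟨c₀, c₁, c₂, c₃, rfl⟩ := exists_eq_ofCoords s
  have h' : ofCoords 0 0 c₀ c₁ = 0 := by
    rw [← h]
    simp only [ofCoords, map_zero]
    linear_combination -(algebraMap k _ c₂ + algebraMap k _ c₃ * U) * V_mul_V (k := k)
  obtain ⟨-, -, rfl, rfl⟩ := ofCoords_eq_zero h'
  refine ⟨algebraMap k _ c₂ + algebraMap k _ c₃ * U, ?_⟩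
  simp only [ofCoords, map_zero]
  ring

lemma exists_eq_mul_U {s : Sring k} (h : s * U = 0) : ∃ s', s = s' * U := by
  obtain ⟨c₀, c₁, c₂, c₃, rfl⟩ := exists_eq_ofCoords s
  have h' : ofCoords 0 c₀ 0 c₂ = 0 := by
    rw [← h]
    simp only [ofCoords, map_zero]
    linear_combination -(algebraMap k _ c₁ + algebraMap k _ c₃ * V) * U_mul_U (k := k)
  obtain ⟨-, rfl, -, rfl⟩ := ofCoords_eq_zero h'
  refine ⟨algebraMap k _ c₁ + algebraMap k _ c₃ * V, ?_⟩
  simp only [ofCoords, map_zero]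
  ring

lemma exists_eq_mul_U_add_mul_V {s : Sring k} (h : πS k s = 0) : ∃ p q, s = p * U + q * V := by
  obtain ⟨c₀, c₁, c₂, c₃, rfl⟩ := exists_eq_ofCoords s
  rw [πS_ofCoords] at h
  subst h
  refine ⟨algebraMap k _ c₁, algebraMap k _ c₂ + algebraMap k _ c₃ * U, ?_⟩
  simp only [ofCoords, map_zero]
  ring

lemma mul_U_mul_V_eq_zero_iff {s : Sring k} : s * (U * V) = 0 ↔ πS k s = 0 := by
  refine ⟨fun h ↦ ?_, fun h ↦ ?_⟩
  · obtain ⟨c₀, c₁, c₂, c₃, rfl⟩ := exists_eq_ofCoords s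
    have h' : ofCoords 0 0 0 c₀ = 0 := by
      rw [← h]
      simp only [ofCoords, map_zero]
      linear_combination -(algebraMap k _ c₁ + algebraMap k _ c₃ * V) * V * U_mul_U (k := k)
        - (algebraMap k _ c₂ * U) * V_mul_V (k := k)
    rw [πS_ofCoords]
    exact (ofCoords_eq_zero h').2.2.2
  · obtain ⟨p, q, rfl⟩ := exists_eq_mul_U_add_mul_V h
    linear_combination p * V * U_mul_U (k := k) + q * U * V_mul_V (k := k)

lemma U_mul_V_ne_zero : (U * V : Sring k) ≠ 0 := by
  rw [← one_mul (U * V), Ne, mul_U_mul_V_eq_zero_iff, map_one]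
  exact one_ne_zero

lemma Rring.ext {r r' : Rring k} (h₁ : r.1.1 = r'.1.1) (h₂ : r.1.2 = r'.1.2) : r = r' :=
  Subtype.ext (Prod.ext h₁ h₂)

lemma πS_fst_eq_πS_snd (r : Rring k) : πS k r.1.1 = πS k r.1.2 := r.2

@[simp] lemma u_fst : (u k).1.1 = U := rfl
@[simp] lemma u_snd : (u k).1.2 = 0 := rfl
@[simp] lemma v_fst : (v k).1.1 = V := rfl
@[simp] lemma v_snd : (v k).1.2 = 0 := rfl
@[simp] lemma x_fst : (x k).1.1 = 0 := rfl
@[simp] lemma x_snd : (x k).1.2 = U := rfl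
@[simp] lemma y_fst : (y k).1.1 = 0 := rfl
@[simp] lemma y_snd : (y k).1.2 = V := rfl

/-- The diagonal lift of an element of `S` (equivalently of `T`, as `S = T`) to `R`. -/
def diag (s : Sring k) : Rring k := ⟨(s, s), rfl⟩

@[simp] lemma diag_fst (s : Sring k) : (diag s).1.1 = s := rfl
@[simp] lemma diag_snd (s : Sring k) : (diag s).1.2 = s := rfl

lemma u_add_x_mul_u : (u k + x k) * u k = 0 := Rring.ext (by simp [U_mul_U]) (by simp)

lemma u_add_x_mul_x : (u k + x k) * x k = 0 := Rring.ext (by simp) (by simp [U_mul_U])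

lemma u_mem_torsionOf : u k ∈ Ideal.torsionOf (Rring k) (Rring k) (u k + x k) := by
  rw [Ideal.mem_torsionOf_iff, smul_eq_mul, mul_comm, u_add_x_mul_u]

lemma x_mem_torsionOf : x k ∈ Ideal.torsionOf (Rring k) (Rring k) (u k + x k) := by
  rw [Ideal.mem_torsionOf_iff, smul_eq_mul, mul_comm, u_add_x_mul_x]

/-- If `z` is a combination of multiples of `u n` and `x n'`, then `z ∈ ann(u + x) N`. -/
lemma mem_torsionOf_smul_top {N : Type} [AddCommGroup N] [Module (Rring k) N] {z n n' : N}
    (r r' : Rring k) (h : z = (r * u k) • n + (r' * x k) • n') :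
    z ∈ Ideal.torsionOf (Rring k) (Rring k) (u k + x k) • (⊤ : Submodule (Rring k) N) := by
  rw [h]
  exact add_mem (Submodule.smul_mem_smul (Ideal.mul_mem_left _ r u_mem_torsionOf) trivial)
    (Submodule.smul_mem_smul (Ideal.mul_mem_left _ r' x_mem_torsionOf) trivial)

/-- If `(s, t) ∈ R` has residue `0`, write its components through the variables. -/
lemma exists_fst_snd_eq {r : Rring k} (h : πS k r.1.1 = 0) :
    ∃ p q p' q' : Sring k, r.1.1 = p * U + q * V ∧ r.1.2 = p' * U + q' * V := by
  obtain ⟨p, q, hpq⟩ := exists_eq_mul_U_add_mul_V h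
  obtain ⟨p', q', hpq'⟩ := exists_eq_mul_U_add_mul_V ((πS_fst_eq_πS_snd r).symm.trans h)
  exact ⟨p, q, p', q', hpq, hpq'⟩

/-- `M = R/(u+x)R`. -/
abbrev TorM (k : Type) [Field k] (N : Type) [AddCommGroup N] [Module (Rring k) N] (i : ℕ) : Prop :=
  TorZero (Rring k) (Rring k ⧸ Ideal.span {u k + x k}) N i

lemma not_torM_zero_quotient : ¬ TorM k (Rring k ⧸ Ideal.span {v k + y k}) 0 := by
  rw [TorM, torZero_zero_iff]
  intro h
  obtain ⟨w, hw⟩ := h (Ideal.Quotient.mk _ 1)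
  obtain ⟨r, rfl⟩ := Ideal.Quotient.mk_surjective w
  have hmem := (Ideal.Quotient.mk_eq_mk_iff_sub_mem (I := Ideal.span {v k + y k}) 1
    ((u k + x k) * r)).1 hw
  obtain ⟨r', hr'⟩ := Ideal.mem_span_singleton'.1 hmem
  have h₁ : r'.1.1 * (V + 0) = 1 - (U + 0) * r.1.1 := congrArg (fun z ↦ z.1.1) hr'
  simpa [πS_U, πS_V] using congrArg (πS k) h₁

lemma not_torM_one_quotient : ¬ TorM k (Rring k ⧸ Ideal.span {v k + y k}) 1 := by
  rw [TorM, torZero_one_iff]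
  intro h
  have hv := h (Ideal.Quotient.mk _ (v k)) (by
    change Ideal.Quotient.mk _ ((u k + x k) * v k) = 0
    refine Ideal.Quotient.eq_zero_iff_mem.2 (Ideal.mem_span_singleton'.2 ⟨u k, ?_⟩)
    exact Rring.ext (by simp) (by simp))
  obtain ⟨j, hj, hjv⟩ : ∃ j ∈ Ideal.torsionOf (Rring k) (Rring k) (u k + x k),
      Ideal.Quotient.mk (Ideal.span {v k + y k}) j = Ideal.Quotient.mk _ (v k) := by
    have hmap := Submodule.map_smul'' (Ideal.torsionOf (Rring k) (Rring k) (u k + x k)) ⊤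
      (Ideal.span {v k + y k}).mkQ
    rw [Submodule.map_top, Submodule.range_mkQ, smul_eq_mul, Ideal.mul_top] at hmap
    rw [← hmap] at hv
    exact hv
  rw [Ideal.Quotient.mk_eq_mk_iff_sub_mem] at hjv
  obtain ⟨r, hr⟩ := Ideal.mem_span_singleton'.1 hjv
  rw [Ideal.mem_torsionOf_iff, smul_eq_mul] at hj
  have key : r * (v k + y k) * (u k + x k) = - (v k * (u k + x k)) := by
    rw [hr]
    linear_combination hj
  have h₁ : r.1.1 * (U * V) = - (U * V) := by
    have : r.1.1 * (V + 0) * (U + 0) = - (V * (U + 0)) := congrArg (fun z ↦ z.1.1) key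
    linear_combination this
  have h₂ : r.1.2 * (U * V) = 0 := by
    have : r.1.2 * (0 + V) * (0 + U) = - (0 * (0 + U)) := congrArg (fun z ↦ z.1.2) key
    linear_combination this
  rw [mul_U_mul_V_eq_zero_iff, ← πS_fst_eq_πS_snd, ← mul_U_mul_V_eq_zero_iff, h₁, neg_eq_zero] at h₂
  exact U_mul_V_ne_zero h₂

lemma torM_one_span : TorM k (Ideal.span {v k + y k}) 1 := by
  rw [TorM, torZero_one_iff]
  rintro ⟨z, hz⟩ haz
  obtain ⟨r, rfl⟩ := Ideal.mem_span_singleton'.1 hz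
  have haz' : (u k + x k) * (r * (v k + y k)) = 0 := congrArg Subtype.val haz
  have h₁ : r.1.1 * (U * V) = 0 := by
    have : (U + 0) * (r.1.1 * (V + 0)) = 0 := congrArg (fun z ↦ z.1.1) haz'
    linear_combination this
  obtain ⟨p, q, p', q', hpq, hpq'⟩ := exists_fst_snd_eq (mul_U_mul_V_eq_zero_iff.1 h₁)
  let b : Ideal.span {v k + y k} := ⟨v k + y k, Ideal.mem_span_singleton_self _⟩
  refine mem_torsionOf_smul_top (n := b) (n' := b) (diag p) (diag p') (Subtype.ext (Rring.ext ?_ ?_))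
  · change r.1.1 * (V + 0) = p * U * (V + 0) + p' * 0 * (V + 0)
    rw [hpq]
    linear_combination q * V_mul_V (k := k)
  · change r.1.2 * (0 + V) = p * 0 * (0 + V) + p' * U * (0 + V)
    rw [hpq']
    linear_combination q' * V_mul_V (k := k)

lemma exists_eq_of_mem_torsionOf {z : Rring k}
    (hz : z ∈ Ideal.torsionOf (Rring k) (Rring k) (v k + y k)) :
    ∃ s t, z.1.1 = s * V ∧ z.1.2 = t * V := by
  rw [Ideal.mem_torsionOf_iff, smul_eq_mul] at hz
  have h₁ : z.1.1 * (V + 0) = 0 := congrArg (fun z ↦ z.1.1) hz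
  have h₂ : z.1.2 * (0 + V) = 0 := congrArg (fun z ↦ z.1.2) hz
  rw [add_zero] at h₁
  rw [zero_add] at h₂
  obtain ⟨s, hs⟩ := exists_eq_mul_V h₁
  obtain ⟨t, ht⟩ := exists_eq_mul_V h₂
  exact ⟨s, t, hs, ht⟩

lemma v_mem_torsionOf : v k ∈ Ideal.torsionOf (Rring k) (Rring k) (v k + y k) := by
  rw [Ideal.mem_torsionOf_iff]
  exact Rring.ext (by simp [V_mul_V]) (by simp)

lemma y_mem_torsionOf : y k ∈ Ideal.torsionOf (Rring k) (Rring k) (v k + y k) := by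
  rw [Ideal.mem_torsionOf_iff]
  exact Rring.ext (by simp) (by simp [V_mul_V])

lemma torM_one_torsionOf : TorM k (Ideal.torsionOf (Rring k) (Rring k) (v k + y k)) 1 := by
  rw [TorM, torZero_one_iff]
  rintro ⟨z, hz⟩ haz
  obtain ⟨s, t, hs, ht⟩ := exists_eq_of_mem_torsionOf hz
  have haz' : (u k + x k) * z = 0 := congrArg Subtype.val haz
  have h₁ : s * (U * V) = 0 := by
    have : (U + 0) * z.1.1 = 0 := congrArg (fun z ↦ z.1.1) haz'
    rw [hs] at this
    linear_combination this
  have h₂ : t * (U * V) = 0 := by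
    have : (0 + U) * z.1.2 = 0 := congrArg (fun z ↦ z.1.2) haz'
    rw [ht] at this
    linear_combination this
  obtain ⟨p, q, hpq⟩ := exists_eq_mul_U_add_mul_V (mul_U_mul_V_eq_zero_iff.1 h₁)
  obtain ⟨p', q', hpq'⟩ := exists_eq_mul_U_add_mul_V (mul_U_mul_V_eq_zero_iff.1 h₂)
  refine mem_torsionOf_smul_top (n := ⟨v k, v_mem_torsionOf⟩) (n' := ⟨y k, y_mem_torsionOf⟩)
    (diag p) (diag p') (Subtype.ext (Rring.ext ?_ ?_))
  · change z.1.1 = p * U * V + p' * 0 * 0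
    rw [hs, hpq]
    linear_combination q * V_mul_V (k := k)
  · change z.1.2 = p * 0 * 0 + p' * U * V
    rw [ht, hpq']
    linear_combination q' * V_mul_V (k := k)

lemma not_torM_one_span_pair : ¬ TorM k (Ideal.span {x k, y k}) 1 := by
  rw [TorM, torZero_one_iff]
  intro h
  have hx := h ⟨x k, Ideal.subset_span (by simp)⟩ (Subtype.ext u_add_x_mul_x)
  have hker : Ideal.torsionOf (Rring k) (Rring k) (u k + x k) • ⊤ ≤
      LinearMap.ker ((y k) • (Ideal.span {x k, y k}).subtype) := by
    rw [Submodule.smul_le]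
    rintro j hj ⟨t, ht⟩ -
    obtain ⟨r, r', rfl⟩ := Ideal.mem_span_pair.1 ht
    rw [Ideal.mem_torsionOf_iff, smul_eq_mul] at hj
    have hjU : j.1.2 * (0 + U) = 0 := congrArg (fun z ↦ z.1.2) hj
    rw [zero_add] at hjU
    rw [LinearMap.mem_ker]
    refine Rring.ext ?_ ?_
    · change 0 * (j.1.1 * (r.1.1 * 0 + r'.1.1 * 0)) = 0
      ring
    · change V * (j.1.2 * (r.1.2 * U + r'.1.2 * V)) = 0
      linear_combination V * r.1.2 * hjU + j.1.2 * r'.1.2 * V_mul_V (k := k)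
  have hxy : y k * x k = 0 := hker hx
  have : V * U = 0 := congrArg (fun z ↦ z.1.2) hxy
  rw [mul_comm] at this
  exact U_mul_V_ne_zero this

/-- The projection of the maximal ideal of `R` onto `m_S`, restricted to an ideal. -/
def projFst (I : Ideal (Rring k)) (hI : ∀ r ∈ I, πS k r.1.1 = 0) : I →ₗ[Rring k] Rring k where
  toFun r := ⟨(r.1.1.1, 0), (hI r.1 r.2).trans (map_zero (πS k)).symm⟩
  map_add' _ _ := Rring.ext rfl (add_zero 0).symm
  map_smul' _ _ := Rring.ext rfl (mul_zero _).symm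

/-- The projection of the maximal ideal of `R` onto `m_T`, restricted to an ideal. -/
def projSnd (I : Ideal (Rring k)) (hI : ∀ r ∈ I, πS k r.1.1 = 0) : I →ₗ[Rring k] Rring k where
  toFun r := ⟨(0, r.1.1.2), (map_zero (πS k)).trans ((hI r.1 r.2).symm.trans (πS_fst_eq_πS_snd r.1))⟩
  map_add' _ _ := Rring.ext (add_zero 0).symm rfl
  map_smul' _ _ := Rring.ext (mul_zero _).symm rfl

/-- Splitting off the summand `vR` from an ideal. -/
lemma torM_span_v_of_le {I : Ideal (Rring k)} (hv : v k ∈ I)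
    (hI : ∀ r ∈ I, ∃ s, r.1.1 = s * V) {i : ℕ} (h : TorM k I i) : TorM k (Ideal.span {v k}) i := by
  have hI' (r) (hr : r ∈ I) : πS k r.1.1 = 0 := by
    obtain ⟨s, hs⟩ := hI r hr
    rw [hs, map_mul, πS_V, mul_zero]
  refine TorZero.of_retract (Submodule.inclusion ((Ideal.span_singleton_le_iff_mem I).2 hv))
    ((projFst I hI').codRestrict (Ideal.span {v k}) fun r ↦ ?_) (fun z ↦ Subtype.ext ?_) h
  · obtain ⟨s, hs⟩ := hI r.1 r.2
    exact Ideal.mem_span_singleton'.2 ⟨diag s, Rring.ext hs.symm (mul_zero s)⟩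
  · obtain ⟨r, hr⟩ := Ideal.mem_span_singleton'.1 z.2
    refine Rring.ext rfl ?_
    rw [← hr]
    exact (mul_zero _).symm

lemma exists_eq_of_mem_torsionOf_v {z : Rring k}
    (hz : z ∈ Ideal.torsionOf (Rring k) (Rring k) (v k)) : ∃ s, z.1.1 = s * V := by
  rw [Ideal.mem_torsionOf_iff, smul_eq_mul] at hz
  exact exists_eq_mul_V (congrArg (fun z ↦ z.1.1) hz)

lemma not_torM_span_v (i : ℕ) : ¬ TorM k (Ideal.span {v k}) (i + 2) := by
  rw [TorM, torZero_span_singleton_add_two_iff]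
  have hI (r) (hr : r ∈ Ideal.torsionOf (Rring k) (Rring k) (v k)) : πS k r.1.1 = 0 := by
    obtain ⟨s, hs⟩ := exists_eq_of_mem_torsionOf_v hr
    rw [hs, map_mul, πS_V, mul_zero]
  induction i with
  | zero =>
    refine mt (fun h ↦ ?_) (not_torM_one_span_pair (k := k))
    have hle : Ideal.span {x k, y k} ≤ Ideal.torsionOf (Rring k) (Rring k) (v k) := by
      refine Ideal.span_le.2 ?_
      rintro _ (rfl | rfl) <;> exact Rring.ext (by simp) (by simp)
    refine TorZero.of_retract (Submodule.inclusion hle)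
      ((projSnd _ hI).codRestrict (Ideal.span {x k, y k}) fun r ↦ ?_) (fun z ↦ Subtype.ext ?_) h
    · obtain ⟨_, _, p, q, -, hpq⟩ := exists_fst_snd_eq (hI r.1 r.2)
      refine Ideal.mem_span_pair.2 ⟨diag p, diag q, Rring.ext ?_ hpq.symm⟩
      change p * 0 + q * 0 = 0
      ring
    · obtain ⟨r, r', hr⟩ := Ideal.mem_span_pair.1 z.2
      refine Rring.ext ?_ rfl
      rw [← hr]
      change 0 = r.1.1 * 0 + r'.1.1 * 0
      ring
  | succ i ih =>
    intro h
    refine ih ((torZero_span_singleton_add_two_iff _ _).1 (torM_span_v_of_le ?_ ?_ h))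
    · rw [Ideal.mem_torsionOf_iff]
      exact Rring.ext (by simp [V_mul_V]) (by simp)
    · exact fun r hr ↦ exists_eq_of_mem_torsionOf_v hr

end Stmt9

open Stmt9 in
/-- Example 2.9: for `S = k[U,V]/(U²,V²)`, `T = k[X,Y]/(X²,Y²)`, `R = S ×ₖ T`,
`M = R/(u+x)R` and `N = R/(v+y)R`, one has `Tor_i^R(M,N) = 0` iff `i = 2` or `i = 3`. -/
theorem stmt_9 (k : Type) [Field k] (i : ℕ) :
    TorZero (Rring k)
      (Rring k ⧸ Ideal.span {u k + x k})
      (Rring k ⧸ Ideal.span {v k + y k}) i ↔ (i = 2 ∨ i = 3) := by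
  match i with
  | 0 => simpa using not_torM_zero_quotient (k := k)
  | 1 => simpa using not_torM_one_quotient (k := k)
  | 2 => simpa using (torZero_quotient_add_two_iff _ 0).2 (torM_one_span (k := k))
  | 3 =>
    simpa using (torZero_quotient_add_two_iff _ 1).2
      ((torZero_span_singleton_add_two_iff _ 0).2 (torM_one_torsionOf (k := k)))
  | i + 4 =>
    rw [torZero_quotient_add_two_iff, torZero_span_singleton_add_two_iff]
    refine iff_of_false (fun h ↦ not_torM_span_v i (torM_span_v_of_le v_mem_torsionOf ?_ h))
      (by omega)
    exact fun r hr ↦ (exists_eq_of_mem_torsionOf hr).imp fun s ⟨_, hs, _⟩ ↦ hs
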